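/- arXiv:2602.16667 — 8 statements merged into one kernel-verified Lean document; each statement's English description precedes it below -/
import Mathlib

section
/- Let N ≥ 2 and m ≥ 1 be integers and let v₁, …, v_N ∈ ℝ^m be vectors of norm 1. Let C := {∑_{i=1}^N ℓᵢvᵢ : ℓᵢ ≥ 0, ∑ᵢℓᵢ = 1} be their convex hull and Δ the interior of C, and assume 0 ∈ Δ. For an integer k ≥ 1 let M := {∑_{i=1}^N ℓᵢvᵢ : each ℓᵢ is a nonnegative integer multiple of 1/(N+1), and ∑ᵢℓᵢ = k − N/(N+1)}. Then k·C ⊆ ⋃_{u∈M} (Δ + u), where k·C := {k·x : x ∈ C} and Δ + u := {x + u : x ∈ Δ}. -/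
open scoped BigOperators

/-- The convex hull `C = {∑ ℓᵢ•vᵢ : ℓᵢ ≥ 0, ∑ℓᵢ = 1}` of the vectors `v i`. -/
def convHullOf {N m : ℕ} (v : Fin N → EuclideanSpace ℝ (Fin m)) :
    Set (EuclideanSpace ℝ (Fin m)) :=
  {x | ∃ ℓ : Fin N → ℝ, (∀ i, 0 ≤ ℓ i) ∧ (∑ i, ℓ i) = 1 ∧ x = ∑ i, ℓ i • v i}

/-- The set `M` of combinations `∑ ℓᵢ•vᵢ` where each `ℓᵢ` is a nonnegative integer multiple
of `1/(N+1)` and `∑ ℓᵢ = k − N/(N+1)`. -/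
def latticePoints {N m : ℕ} (v : Fin N → EuclideanSpace ℝ (Fin m)) (k : ℕ) :
    Set (EuclideanSpace ℝ (Fin m)) :=
  {x | ∃ ℓ : Fin N → ℝ, (∀ i, 0 ≤ ℓ i ∧ ∃ j : ℕ, ℓ i = (j : ℝ) / (N + 1)) ∧
    (∑ i, ℓ i) = (k : ℝ) - (N : ℝ) / (N + 1) ∧ x = ∑ i, ℓ i • v i}

/-- A family of natural numbers with sum at least `T` dominates a family with sum exactly `T`. -/
theorem exists_le_sum_eq_nat {ι : Type*} (s : Finset ι) (f : ι → ℕ) (T : ℕ)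
    (hT : T ≤ ∑ i ∈ s, f i) : ∃ g : ι → ℕ, (∀ i ∈ s, g i ≤ f i) ∧ ∑ i ∈ s, g i = T := by
  classical
  induction s using Finset.induction_on generalizing T with
  | empty => exact ⟨f, by simp, by simp at hT ⊢; omega⟩
  | insert a s ha ih =>
    rw [Finset.sum_insert ha] at hT
    obtain ⟨g, hg, hgT⟩ := ih (T - f a) (by omega)
    refine ⟨Function.update g a (min T (f a)), fun i hi => ?_, ?_⟩
    · rcases eq_or_ne i a with rfl | hia
      · simp
      · simpa [hia] using hg i (Finset.mem_of_mem_insert_of_ne hi hia)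
    · rw [Finset.sum_insert ha, Finset.sum_update_of_notMem ha, hgT, Function.update_self]
      omega

theorem convex_convHullOf {N m : ℕ} (v : Fin N → EuclideanSpace ℝ (Fin m)) :
    Convex ℝ (convHullOf v) := by
  rintro _ ⟨p, hp, hp1, rfl⟩ _ ⟨q, hq, hq1, rfl⟩ a b ha hb hab
  refine ⟨fun i => a * p i + b * q i, fun i => ?_, ?_, ?_⟩
  · have := hp i
    have := hq i
    positivity
  · rw [Finset.sum_add_distrib, ← Finset.mul_sum, ← Finset.mul_sum, hp1, hq1]
    linarith
  · simp [add_smul, mul_smul, Finset.sum_add_distrib, Finset.smul_sum]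

/-- A nonnegative combination with total weight in `(0, 1)` lies in the interior of the hull. -/
theorem sum_smul_mem_interior_convHullOf {N m : ℕ} (v : Fin N → EuclideanSpace ℝ (Fin m))
    (h0 : (0 : EuclideanSpace ℝ (Fin m)) ∈ interior (convHullOf v))
    (r : Fin N → ℝ) (hr : ∀ i, 0 ≤ r i) (hpos : 0 < ∑ i, r i) (hlt : ∑ i, r i < 1) :
    ∑ i, r i • v i ∈ interior (convHullOf v) := by
  set t := ∑ i, r i with ht
  have hmem : ∑ i, (r i / t) • v i ∈ convHullOf v :=
    ⟨fun i => r i / t, fun i => div_nonneg (hr i) hpos.le,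
      by rw [← Finset.sum_div, ← ht, div_self hpos.ne'], rfl⟩
  have := (convex_convHullOf v).combo_interior_self_mem_interior h0 hmem
    (sub_pos.2 hlt) hpos.le (sub_add_cancel 1 t)
  simpa [Finset.smul_sum, smul_smul, mul_div_cancel₀ _ hpos.ne'] using this

/-- if `0` lies in the interior `Δ` of the convex hull `C` of unit vectors
`v₁, …, v_N`, then `k·C ⊆ ⋃_{u ∈ M} (Δ + u)`. -/
theorem stmt_5 (N m : ℕ) (hN : 2 ≤ N) (hm : 1 ≤ m)
    (v : Fin N → EuclideanSpace ℝ (Fin m)) (hv : ∀ i, ‖v i‖ = 1)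
    (h0 : (0 : EuclideanSpace ℝ (Fin m)) ∈ interior (convHullOf v))
    (k : ℕ) (hk : 1 ≤ k) :
    ∀ x ∈ convHullOf v, ∃ u ∈ latticePoints v k,
      (k : ℝ) • x - u ∈ interior (convHullOf v) := by
  rintro x ⟨p, hp, hp1, rfl⟩
  have hN1 : (0 : ℝ) < N + 1 := by positivity
  have hN0 : (0 : ℝ) < N := by exact_mod_cast (by omega : 0 < N)
  have hkN : N ≤ k * (N + 1) := by nlinarith
  have hfloor : k * (N + 1) - N ≤ ∑ i, ⌊(N + 1) * (k * p i)⌋₊ := by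
    have hsum : ∑ i, ((N + 1) * (k * p i)) ≤ ∑ i, ((⌊(N + 1) * (k * p i)⌋₊ : ℝ) + 1) :=
      Finset.sum_le_sum fun i _ => (Nat.lt_floor_add_one _).le
    rw [← Finset.mul_sum, ← Finset.mul_sum, hp1, Finset.sum_add_distrib] at hsum
    simp only [Finset.sum_const, Finset.card_univ, Fintype.card_fin, nsmul_eq_mul,
      mul_one] at hsum
    rw [tsub_le_iff_right]
    have : ((k * (N + 1) : ℕ) : ℝ) ≤ ((∑ i, ⌊(N + 1) * (k * p i)⌋₊ + N : ℕ) : ℝ) := by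
      push_cast
      linarith
    exact_mod_cast this
  obtain ⟨j, hj, hjsum⟩ := exists_le_sum_eq_nat _ _ _ hfloor
  have hsum : ∑ i, (j i : ℝ) / (N + 1) = k - N / (N + 1) := by
    rw [← Finset.sum_div, ← Nat.cast_sum, hjsum, Nat.cast_sub hkN]
    push_cast
    field_simp
  have hrem : ∑ i, (k * p i - j i / (N + 1)) = (N : ℝ) / (N + 1) := by
    rw [Finset.sum_sub_distrib, ← Finset.mul_sum, hp1, hsum]
    ring
  refine ⟨∑ i, ((j i : ℝ) / (N + 1)) • v i,
    ⟨fun i => j i / (N + 1), fun i => ⟨by positivity, j i, rfl⟩, hsum, rfl⟩, ?_⟩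
  have hmem := sum_smul_mem_interior_convHullOf v h0
    (fun i => k * p i - j i / (N + 1)) (fun i => ?_) (by rw [hrem]; positivity)
    (by rw [hrem, div_lt_one hN1]; linarith)
  · simpa [sub_smul, mul_smul, Finset.sum_sub_distrib, Finset.smul_sum] using hmem
  · have hpi := hp i
    have h1 : (j i : ℝ) ≤ (N + 1) * (k * p i) :=
      (Nat.cast_le.2 (hj i (Finset.mem_univ i))).trans (Nat.floor_le (by positivity))
    rw [sub_nonneg, div_le_iff₀ hN1]
    linarith
end

section
/- Let N ≥ 2 and m ≥ 1 be integers and let v₁, …, v_N ∈ ℝ^m be vectors of norm 1. Let C be their convex hull and Δ the interior of C, and assume 0 ∈ Δ. For an integer k ≥ 1 let M := {∑_{i=1}^N ℓᵢvᵢ : each ℓᵢ is a nonnegative integer multiple of 1/(N+1), and ∑ᵢℓᵢ = k − N/(N+1)}. Then there exists c > 0 such that for every r > 0, k·r·C ⊆ ⋃_{u∈M} (r·Δ + r·u)_{(c·r)}, where for a set A ⊆ ℝ^m and δ > 0, A_{(δ)} := {x ∈ A : the open ball of radius δ around x is contained in A}. -/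
open scoped BigOperators

/-- A family of natural numbers dominates a family with any prescribed smaller sum. -/
theorem exists_le_sum_eq {ι : Type*} [Fintype ι] (g : ι → ℕ) (n : ℕ) (hn : n ≤ ∑ i, g i) :
    ∃ f : ι → ℕ, (∀ i, f i ≤ g i) ∧ ∑ i, f i = n := by
  classical
  induction n with
  | zero => exact ⟨0, fun i => Nat.zero_le _, by simp⟩
  | succ n ih =>
    obtain ⟨f, hf, hsum⟩ := ih (by omega)
    obtain ⟨i, -, hi⟩ := Finset.exists_lt_of_sum_lt (s := Finset.univ) (f := f) (g := g)
      (by omega)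
    refine ⟨f + Pi.single i 1, fun j => ?_, ?_⟩
    · rcases eq_or_ne j i with rfl | hj
      · simpa using hi
      · simpa [hj] using hf j
    · simp [Finset.sum_add_distrib, hsum]

/-- Nonnegative reals with sum `k` dominate nonnegative multiples of `1 / (N + 1)` with
sum `k - N / (N + 1)`. -/
theorem exists_lattice_le {N k : ℕ} (hk : 1 ≤ k) (t : Fin N → ℝ) (ht : ∀ i, 0 ≤ t i)
    (hsum : ∑ i, t i = k) :
    ∃ f : Fin N → ℕ, (∀ i, (f i : ℝ) / (N + 1) ≤ t i) ∧
      ∑ i, (f i : ℝ) / (N + 1) = (k : ℝ) - (N : ℝ) / (N + 1) := by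
  have hN : (0 : ℝ) < N + 1 := by positivity
  have hle : N ≤ k * (N + 1) := by nlinarith
  have hfloor : k * (N + 1) - N ≤ ∑ i, ⌊t i * (N + 1)⌋₊ := by
    have h : ∑ i, t i * ((N : ℝ) + 1) ≤ ∑ i, ((⌊t i * (N + 1)⌋₊ : ℝ) + 1) :=
      Finset.sum_le_sum fun i _ => (Nat.lt_floor_add_one _).le
    rw [← Finset.sum_mul, hsum, Finset.sum_add_distrib] at h
    simp only [Finset.sum_const, Finset.card_univ, Fintype.card_fin, nsmul_eq_mul, mul_one] at h
    have h' : k * (N + 1) ≤ ∑ i, ⌊t i * (N + 1)⌋₊ + N := by exact_mod_cast h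
    omega
  obtain ⟨f, hf, hfs⟩ := exists_le_sum_eq _ _ hfloor
  refine ⟨f, fun i => ?_, ?_⟩
  · rw [div_le_iff₀ hN]
    exact (Nat.cast_le.mpr (hf i)).trans (Nat.floor_le (mul_nonneg (ht i) hN.le))
  · rw [← Finset.sum_div, ← Nat.cast_sum, hfs, Nat.cast_sub hle]
    push_cast
    field_simp

/-- If `C` contains the ball of radius `ρ` about `0`, then the ball of radius `ρ / (N + 1)` about
a point of `(N / (N + 1)) • C` lies in `C`. -/
theorem ball_subset_convHullOf {N m : ℕ} {v : Fin N → EuclideanSpace ℝ (Fin m)} {ρ : ℝ}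
    (hρ : Metric.ball 0 ρ ⊆ convHullOf v) {s : Fin N → ℝ} (hs : ∀ i, 0 ≤ s i)
    (hsum : ∑ i, s i = (N : ℝ) / (N + 1)) :
    Metric.ball (∑ i, s i • v i) (ρ / (N + 1)) ⊆ convHullOf v := by
  intro z hz
  have hN : (0 : ℝ) < N + 1 := by positivity
  have hmem : ((N : ℝ) + 1) • (z - ∑ i, s i • v i) ∈
      Metric.ball (0 : EuclideanSpace ℝ (Fin m)) ρ := by
    rw [mem_ball_zero_iff, norm_smul, Real.norm_of_nonneg hN.le, ← dist_eq_norm, mul_comm]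
    exact (lt_div_iff₀ hN).mp hz
  obtain ⟨p, hp, hp1, hpe⟩ := hρ hmem
  refine ⟨fun i => s i + p i / (N + 1), fun i => add_nonneg (hs i) (div_nonneg (hp i) hN.le),
    ?_, ?_⟩
  · rw [Finset.sum_add_distrib, hsum, ← Finset.sum_div, hp1]
    field_simp
  · have h : ∑ i, (p i / ((N : ℝ) + 1)) • v i = z - ∑ i, s i • v i := by
      simp_rw [div_eq_inv_mul, mul_smul]
      rw [← Finset.smul_sum, ← hpe, inv_smul_smul₀ hN.ne']
    simp_rw [add_smul]
    rw [Finset.sum_add_distrib, h, add_sub_cancel]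

/-- if `0` lies in the interior `Δ` of the convex hull `C` of unit vectors
`v₁, …, v_N`, then there is `c > 0` such that for all `r > 0`,
`k·r·C ⊆ ⋃_{u ∈ M} (r·Δ + r·u)_{(c·r)}`, where `A_{(δ)}` is the `δ`-interior of `A`. -/
theorem stmt_6 (N m : ℕ) (hN : 2 ≤ N) (hm : 1 ≤ m)
    (v : Fin N → EuclideanSpace ℝ (Fin m)) (hv : ∀ i, ‖v i‖ = 1)
    (h0 : (0 : EuclideanSpace ℝ (Fin m)) ∈ interior (convHullOf v))
    (k : ℕ) (hk : 1 ≤ k) :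
    ∃ c : ℝ, 0 < c ∧ ∀ r : ℝ, 0 < r →
      ∀ y, (∃ x ∈ convHullOf v, y = ((k : ℝ) * r) • x) →
        ∃ u ∈ latticePoints v k,
          y ∈ {z | ∃ w ∈ interior (convHullOf v), z = r • w + r • u} ∧
          ∀ z, dist z y < c * r →
            z ∈ {z' | ∃ w ∈ interior (convHullOf v), z' = r • w + r • u} := by
  obtain ⟨ρ, hρ, hball⟩ := Metric.mem_nhds_iff.mp (mem_interior_iff_mem_nhds.mp h0)
  have hc : 0 < ρ / ((N : ℝ) + 1) := by positivity
  refine ⟨ρ / (N + 1), hc, ?_⟩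
  rintro r hr y ⟨x, ⟨ℓ, hℓ, hℓ1, rfl⟩, rfl⟩
  obtain ⟨f, hf, hfs⟩ := exists_lattice_le hk (fun i => k * ℓ i)
    (fun i => mul_nonneg k.cast_nonneg (hℓ i)) (by rw [← Finset.mul_sum, hℓ1, mul_one])
  set u := ∑ i, ((f i : ℝ) / (N + 1)) • v i with hu
  set s : Fin N → ℝ := fun i => k * ℓ i - f i / (N + 1) with hs
  have hsub : Metric.ball (∑ i, s i • v i) (ρ / (N + 1)) ⊆ interior (convHullOf v) :=
    interior_maximal (ball_subset_convHullOf hball (fun i => sub_nonneg.mpr (hf i)) (by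
      rw [hs, Finset.sum_sub_distrib, hfs, ← Finset.mul_sum, hℓ1]; ring)) Metric.isOpen_ball
  have hy : ((k : ℝ) * r) • ∑ i, ℓ i • v i = r • (∑ i, s i • v i + u) := by
    simp_rw [hu, hs, ← Finset.sum_add_distrib, ← add_smul, sub_add_cancel, Finset.smul_sum,
      smul_smul]
    exact Finset.sum_congr rfl fun i _ => by congr 1; ring
  have key : ∀ z, dist z (((k : ℝ) * r) • ∑ i, ℓ i • v i) < ρ / (N + 1) * r →
      z ∈ {z' | ∃ w ∈ interior (convHullOf v), z' = r • w + r • u} := by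
    intro z hz
    have hz' : z = r • (r⁻¹ • z - u) + r • u := by
      rw [← smul_add, sub_add_cancel, smul_inv_smul₀ hr.ne']
    refine ⟨r⁻¹ • z - u, hsub ?_, hz'⟩
    rw [hy, smul_add] at hz
    nth_rewrite 1 [hz'] at hz
    rw [dist_add_right, dist_smul₀, Real.norm_of_nonneg hr.le, mul_comm] at hz
    exact lt_of_mul_lt_mul_right hz hr.le
  exact ⟨u, ⟨_, fun i => ⟨by positivity, f i, rfl⟩, hfs, hu⟩,
    key _ (by rw [dist_self]; positivity), key⟩
end

section
/- For all integers N ≥ 2 and k ≥ 2, the binomial coefficient C((N+1)·k − 1, N − 1) satisfies C((N+1)·k − 1, N − 1) < e^{N+1} · k^{N−1}. -/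
/-- for integers `N ≥ 2` and `k ≥ 2`,
`C((N+1)k − 1, N − 1) < e^{N+1} · k^{N−1}`. -/
theorem stmt_7 (N k : ℕ) (hN : 2 ≤ N) (hk : 2 ≤ k) :
    (Nat.choose ((N + 1) * k - 1) (N - 1) : ℝ) <
      Real.exp ((N : ℝ) + 1) * (k : ℝ) ^ (N - 1) := by
  have hlt : (((N + 1) * k - 1 : ℕ) : ℝ) < ((N : ℝ) + 1) * k := by
    have h : (N + 1) * k - 1 < (N + 1) * k := Nat.sub_lt (by positivity) one_pos
    exact_mod_cast h
  calc (Nat.choose ((N + 1) * k - 1) (N - 1) : ℝ)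
      ≤ (((N + 1) * k - 1 : ℕ) : ℝ) ^ (N - 1) / (N - 1).factorial :=
        Nat.choose_le_pow_div _ _
    _ < (((N : ℝ) + 1) * k) ^ (N - 1) / (N - 1).factorial := by
        have hr : N - 1 ≠ 0 := by omega
        gcongr
    _ = ((N : ℝ) + 1) ^ (N - 1) / (N - 1).factorial * (k : ℝ) ^ (N - 1) := by
        rw [mul_pow]; ring
    _ ≤ Real.exp ((N : ℝ) + 1) * (k : ℝ) ^ (N - 1) := by
        gcongr
        exact Real.pow_div_factorial_le_exp _ (by positivity) _
end

section
/- Let (X, d) be a locally compact metric space, let V ⊆ X be a nonempty open set with compact closure, and let f₁, …, f_k : X → X be finitely many continuous maps such that cl(V) ⊆ ⋃_{i=1}^k fᵢ⁻¹(V). Then there exists δ > 0 such that B_δ(V) ⊆ ⋃_{i=1}^k fᵢ⁻¹(V_{(δ)}), where B_δ(V) := ⋃_{v∈V} B_δ(v) is the open δ-neighborhood of V and V_{(δ)} := {v ∈ V : B_δ(v) ⊆ V} is the δ-interior of V. -/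
/-- in a locally compact metric space, the covering condition
`cl(V) ⊆ ⋃ᵢ fᵢ⁻¹(V)` for a nonempty open `V` with compact closure and finitely many
continuous maps implies the strong covering condition: there is `δ > 0` with
`B_δ(V) ⊆ ⋃ᵢ fᵢ⁻¹(V_{(δ)})`. -/
theorem stmt_9 {X : Type*} [MetricSpace X] [LocallyCompactSpace X]
    (V : Set X) (hVne : V.Nonempty) (hVopen : IsOpen V) (hVcpt : IsCompact (closure V))
    (k : ℕ) (f : Fin k → X → X) (hf : ∀ i, Continuous (f i))
    (hcov : ∀ x ∈ closure V, ∃ i, f i x ∈ V) :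
    ∃ δ : ℝ, 0 < δ ∧ ∀ x : X, (∃ v ∈ V, dist x v < δ) →
      ∃ i, f i x ∈ V ∧ ∀ y : X, dist y (f i x) < δ → y ∈ V := by
  have hloc : ∀ x ∈ closure V, ∃ ε : ℝ, 0 < ε ∧
      ∀ᶠ z in nhds x, ∃ i, Metric.ball (f i z) ε ⊆ V := by
    intro x hx
    obtain ⟨i, hi⟩ := hcov x hx
    obtain ⟨ε, hε, hball⟩ := Metric.isOpen_iff.1 hVopen _ hi
    refine ⟨ε / 2, half_pos hε, ?_⟩
    filter_upwards [(hf i).continuousAt.eventually (Metric.ball_mem_nhds _ (half_pos hε))]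
      with z hz
    exact ⟨i, (Metric.ball_subset_ball' (by linarith [Metric.mem_ball.1 hz])).trans hball⟩
  obtain ⟨ε, hε, hsub⟩ : ∃ ε : ℝ, 0 < ε ∧
      ∀ᶠ z in nhdsSet (closure V), ∃ i, Metric.ball (f i z) ε ⊆ V := by
    have hcompact : ∃ ε : ℝ, 0 < ε ∧
        ∀ x ∈ closure V, ∀ᶠ z in nhds x, ∃ i, Metric.ball (f i z) ε ⊆ V := by
      refine hVcpt.induction_on (p := fun s => ∃ ε : ℝ, 0 < ε ∧
        ∀ x ∈ s, ∀ᶠ z in nhds x, ∃ i, Metric.ball (f i z) ε ⊆ V) ?_ ?_ ?_ ?_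
      · exact ⟨1, one_pos, by simp⟩
      · rintro s t hst ⟨ε, hε, h⟩
        exact ⟨ε, hε, fun x hx => h x (hst hx)⟩
      · rintro s t ⟨ε₁, hε₁, h₁⟩ ⟨ε₂, hε₂, h₂⟩
        refine ⟨min ε₁ ε₂, lt_min hε₁ hε₂, ?_⟩
        rintro x (hx | hx)
        · filter_upwards [h₁ x hx] with z ⟨i, hi⟩
          exact ⟨i, (Metric.ball_subset_ball (min_le_left _ _)).trans hi⟩
        · filter_upwards [h₂ x hx] with z ⟨i, hi⟩
          exact ⟨i, (Metric.ball_subset_ball (min_le_right _ _)).trans hi⟩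
      · intro x hx
        obtain ⟨ε, hε, h⟩ := hloc x hx
        exact ⟨_, mem_nhdsWithin_of_mem_nhds h.eventually_nhds, ε, hε, fun _ hy => hy⟩
    simpa only [eventually_nhdsSet_iff_forall] using hcompact
  obtain ⟨U, hUopen, hVU, hU⟩ := eventually_nhdsSet_iff_exists.1 hsub
  obtain ⟨η, hη, hthick⟩ := hVcpt.exists_thickening_subset_open hUopen hVU
  refine ⟨min ε η, lt_min hε hη, ?_⟩
  rintro x ⟨v, hv, hxv⟩
  obtain ⟨i, hi⟩ := hU x (hthick (Metric.mem_thickening_iff.2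
    ⟨v, subset_closure hv, hxv.trans_le (min_le_right _ _)⟩))
  exact ⟨i, hi (Metric.mem_ball_self hε), fun y hy => hi (hy.trans_le (min_le_left _ _))⟩
end

section
/- Let (X, d) be a metric space, V ⊆ X a nonempty set, and f₁, …, f_k : X → X maps for which there exists δ > 0 with B_δ(V) ⊆ ⋃_{i=1}^k fᵢ⁻¹(V_{(δ)}). Let 0 ≤ ε < δ and let g₁, …, g_k : X → X be maps with sup_{x∈X} d(fᵢ(x), gᵢ(x)) ≤ ε for each i. Then B_{δ−ε}(V) ⊆ ⋃_{i=1}^k gᵢ⁻¹(V_{(δ−ε)}); in particular cl(V) ⊆ ⋃_{i=1}^k gᵢ⁻¹(V). -/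
/-- stability of the strong covering condition. If
`B_δ(V) ⊆ ⋃ᵢ fᵢ⁻¹(V_{(δ)})` and the maps `gᵢ` satisfy `sup_x d(fᵢ(x), gᵢ(x)) ≤ ε` with
`0 ≤ ε < δ`, then `B_{δ−ε}(V) ⊆ ⋃ᵢ gᵢ⁻¹(V_{(δ−ε)})`; in particular
`cl(V) ⊆ ⋃ᵢ gᵢ⁻¹(V)`. -/
theorem stmt_10 {X : Type*} [MetricSpace X]
    (V : Set X) (hVne : V.Nonempty)
    (k : ℕ) (f g : Fin k → X → X) (δ ε : ℝ) (hδ : 0 < δ)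
    (hcov : ∀ x : X, (∃ v ∈ V, dist x v < δ) →
      ∃ i, f i x ∈ V ∧ ∀ y : X, dist y (f i x) < δ → y ∈ V)
    (hε0 : 0 ≤ ε) (hεδ : ε < δ)
    (happrox : ∀ i, ∀ x : X, dist (f i x) (g i x) ≤ ε) :
    (∀ x : X, (∃ v ∈ V, dist x v < δ - ε) →
      ∃ i, g i x ∈ V ∧ ∀ y : X, dist y (g i x) < δ - ε → y ∈ V) ∧
    (∀ x ∈ closure V, ∃ i, g i x ∈ V) := by
  have main : ∀ x : X, (∃ v ∈ V, dist x v < δ - ε) →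
      ∃ i, g i x ∈ V ∧ ∀ y : X, dist y (g i x) < δ - ε → y ∈ V := by
    rintro x ⟨v, hv, hxv⟩
    obtain ⟨i, -, hball⟩ := hcov x ⟨v, hv, by linarith⟩
    have hfg := happrox i x
    refine ⟨i, hball _ ?_, fun y hy => hball _ ?_⟩
    · rw [dist_comm]
      linarith
    · have := dist_triangle_right y (f i x) (g i x)
      linarith
  refine ⟨main, fun x hx => ?_⟩
  obtain ⟨i, hi, -⟩ := main x (Metric.mem_closure_iff.1 hx (δ - ε) (by linarith))
  exact ⟨i, hi⟩
end

section
/- For every γ ∈ (0,1), every integer c ≥ 2, and every ε > 0 there exist: a real number ℓ ∈ (0,1); positive integers n and n′ with c dividing n′; real numbers a > 0, z₀ ∈ ℝ, L > 0, and δ with 0 < δ < L/2; real numbers t₁ > t₂ > ⋯ > t_n and t′₁ < t′₂ < ⋯ < t′_{n′}, all lying in [0, 1 − ℓ]; and a partition of {1, …, n′} into c sets S₁, …, S_c; such that: (i) ℓ^{−γ} < n < ℓ^{−(γ+ε)} and ℓ^{−(1−γ)} < n′ < ℓ^{−(1−γ+ε)}; (ii) t_i − t_{i+1} > ℓ for all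 1 ≤ i < n, and t′_{j+1} − t′_j > ℓ for all 1 ≤ j < n′; (iii) for every t ∈ [z₀ − L, z₀] and every l ∈ {1, …, c} there exist i ∈ {1, …, n} and j ∈ S_l with ℓ⁻¹·(a·t′_j + t − t_i) ∈ [z₀ − L + δ, z₀ − δ]. -/
/-- Between two powers of a small `ℓ⁻¹` with exponents differing by `η` there is a multiple of `k`,
provided `ℓ ^ (-η)` is large compared with `k`. -/
lemma exists_mul_between_rpow {ℓ α η : ℝ} {k : ℕ} (hℓ0 : 0 < ℓ) (hℓ1 : ℓ < 1) (hα : 0 < α)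
    (hη : 0 < η) (hαη : α + 2 * η ≤ 1) (hk : 1 ≤ k) (hkη : 4 * (k : ℝ) < ℓ ^ (-η)) :
    ∃ K : ℕ, 0 < K ∧ ℓ ^ (-(α + η)) ≤ K ∧ ((k * K : ℕ) : ℝ) < ℓ ^ (-(α + 2 * η)) ∧
      (((k * K : ℕ) : ℝ) + 1) * ℓ < 1 := by
  set B := ℓ ^ (-(α + η)) with hB
  have hB1 : 1 < B := Real.one_lt_rpow_of_pos_of_lt_one_of_neg hℓ0 hℓ1 (by linarith)
  have hmul : ℓ ^ (-(α + 2 * η)) = ℓ ^ (-η) * B := by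
    rw [hB, ← Real.rpow_add hℓ0]; congr 1; ring
  have hle : ℓ ^ (-(α + 2 * η)) ≤ ℓ⁻¹ := by
    rw [← Real.rpow_neg_one]
    exact Real.rpow_le_rpow_of_exponent_ge hℓ0 hℓ1.le (by linarith)
  have hk1 : (1 : ℝ) ≤ k := by exact_mod_cast hk
  have hceil : (⌈B⌉₊ : ℝ) < B + 1 := Nat.ceil_lt_add_one (by linarith)
  have hkK : (k : ℝ) * ⌈B⌉₊ + 1 < ℓ ^ (-(α + 2 * η)) := by
    rw [hmul]
    have h₁ : (k : ℝ) * ⌈B⌉₊ ≤ k * (2 * B) := by gcongr; linarith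
    have h₂ : 4 * (k : ℝ) * B < ℓ ^ (-η) * B := by gcongr
    nlinarith
  refine ⟨⌈B⌉₊, Nat.ceil_pos.2 (by linarith), Nat.le_ceil B, ?_, ?_⟩
  · push_cast; linarith
  · push_cast
    calc ((k : ℝ) * ⌈B⌉₊ + 1) * ℓ < ℓ⁻¹ * ℓ := by gcongr; linarith
      _ = 1 := inv_mul_cancel₀ hℓ0.ne'

/-- An arithmetic progression of step `s * c` and offset `s * l` meets every interval `[w, w + s * c]`
to the right of `s * c`. -/
lemma exists_arith_progression_mem_Icc {s w : ℝ} {c l : ℕ} (hs : 0 < s) (hl : l < c)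
    (hw : s * c ≤ w) : ∃ y : ℕ, s * (c * y + l : ℕ) ∈ Set.Icc w (w + s * c) := by
  have hc : (0 : ℝ) < c := by exact_mod_cast (Nat.zero_le l).trans_lt hl
  have hlc : (l : ℝ) < c := by exact_mod_cast hl
  have hnn : 0 ≤ (w / s - l) / c := by
    have : (c : ℝ) ≤ w / s := by rw [le_div_iff₀ hs]; linarith
    exact div_nonneg (by linarith) hc.le
  refine ⟨⌈(w / s - l) / c⌉₊, ?_⟩
  have h₁ := Nat.le_ceil ((w / s - l) / c)
  have h₂ := Nat.ceil_lt_add_one hnn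
  set y : ℝ := (⌈(w / s - l) / c⌉₊ : ℝ)
  rw [div_le_iff₀ hc, sub_le_iff_le_add, div_le_iff₀ hs] at h₁
  rw [← sub_lt_iff_lt_add, lt_div_iff₀ hc, lt_sub_iff_add_lt, lt_div_iff₀ hs] at h₂
  push_cast
  constructor <;> nlinarith


/-- existence of a pair of homogeneous iterated function systems on `[0,1]`
(with common contraction ratio `ℓ`, translation parameters `t i` and `t' j`) whose generated
Cantor sets have dimensions `(log n)/(-log ℓ) ∈ (γ, γ+ε)` and
`(log n')/(-log ℓ) ∈ (1−γ, 1−γ+ε)` (condition (i)), which are genuinely Cantor systems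
(condition (ii): gaps bigger than `ℓ`), and such that the segment `{a} × [z₀ − L, z₀]`
satisfies the `c`-separable covering condition (iii) with respect to the compositions
`R′_j ∘ R_i⁻¹` of the renormalization operators; the partition of `{1, …, n′}` into `c` sets
`S₁, …, S_c` is encoded by the fibers of `σ : Fin n' → Fin c`. -/
theorem stmt_11 (γ : ℝ) (hγ0 : 0 < γ) (hγ1 : γ < 1) (c : ℕ) (hc : 2 ≤ c)
    (ε : ℝ) (hε : 0 < ε) :
    ∃ (ℓ : ℝ) (n n' : ℕ) (a z₀ L δ : ℝ) (t : Fin n → ℝ) (t' : Fin n' → ℝ)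
      (σ : Fin n' → Fin c),
      0 < ℓ ∧ ℓ < 1 ∧ 0 < n ∧ 0 < n' ∧ c ∣ n' ∧
      0 < a ∧ 0 < L ∧ 0 < δ ∧ δ < L / 2 ∧
      StrictAnti t ∧ StrictMono t' ∧
      (∀ i, t i ∈ Set.Icc (0 : ℝ) (1 - ℓ)) ∧ (∀ j, t' j ∈ Set.Icc (0 : ℝ) (1 - ℓ)) ∧
      -- (i)
      (ℓ ^ (-γ) < (n : ℝ) ∧ (n : ℝ) < ℓ ^ (-(γ + ε))) ∧
      (ℓ ^ (-(1 - γ)) < (n' : ℝ) ∧ (n' : ℝ) < ℓ ^ (-(1 - γ + ε))) ∧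
      -- (ii)
      (∀ (i : ℕ) (h : i + 1 < n), t ⟨i, by omega⟩ - t ⟨i + 1, h⟩ > ℓ) ∧
      (∀ (j : ℕ) (h : j + 1 < n'), t' ⟨j + 1, h⟩ - t' ⟨j, by omega⟩ > ℓ) ∧
      -- (iii)
      (∀ τ ∈ Set.Icc (z₀ - L) z₀, ∀ l : Fin c,
        ∃ (i : Fin n) (j : Fin n'), σ j = l ∧
          ℓ⁻¹ * (a * t' j + τ - t i) ∈ Set.Icc (z₀ - L + δ) (z₀ - δ)) := by
  set η := min ε (min γ (1 - γ)) / 2 with hη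
  have hη0 : 0 < η := half_pos (lt_min hε (lt_min hγ0 (by linarith)))
  have hηε : 2 * η ≤ ε := by rw [hη]; linarith [min_le_left ε (min γ (1 - γ))]
  have hηm : 2 * η ≤ min γ (1 - γ) := by rw [hη]; linarith [min_le_right ε (min γ (1 - γ))]
  have hηγ : 2 * η ≤ γ := hηm.trans (min_le_left _ _)
  have hηγ' : 2 * η ≤ 1 - γ := hηm.trans (min_le_right _ _)
  have hc2 : (2 : ℝ) ≤ c := by exact_mod_cast hc
  have hc0 : 0 < c := by omega
  obtain ⟨ℓ, hℓ⟩ : ∃ ℓ : ℝ, ℓ = (5 * (c : ℝ)) ^ (-η⁻¹) := ⟨_, rfl⟩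
  have hℓ0 : 0 < ℓ := by rw [hℓ]; positivity
  have hℓη : ℓ ^ (-η) = 5 * c := by
    rw [hℓ, ← Real.rpow_mul (by positivity), neg_mul_neg, inv_mul_cancel₀ hη0.ne', Real.rpow_one]
  have hℓ10 : ℓ ≤ 1 / 10 := by
    have h₁ : 1 ≤ η⁻¹ := (one_le_inv₀ hη0).2 (by linarith)
    calc ℓ ≤ (5 * (c : ℝ)) ^ (-1 : ℝ) := by
          rw [hℓ]; exact Real.rpow_le_rpow_of_exponent_le (by linarith) (by linarith)
      _ = 1 / (5 * c) := by rw [Real.rpow_neg_one, one_div]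
      _ ≤ 1 / 10 := by gcongr; linarith
  have hℓ1 : ℓ < 1 := by linarith
  obtain ⟨n, hn0, hnA, hnU, hnℓ⟩ := exists_mul_between_rpow (k := 1) hℓ0 hℓ1 hγ0 hη0
    (by linarith) le_rfl (by rw [hℓη]; push_cast; linarith)
  obtain ⟨K, hK0, hKB, hKU, hKℓ⟩ := exists_mul_between_rpow (α := 1 - γ) (k := c) hℓ0 hℓ1
    (by linarith) hη0 (by linarith) hc0 (by rw [hℓη]; linarith)
  rw [one_mul] at hnU hnℓ
  have hanti {x y : ℝ} (h : x ≤ y) : ℓ ^ y ≤ ℓ ^ x :=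
    Real.rpow_le_rpow_of_exponent_ge hℓ0 hℓ1.le h
  have hanti' {x y : ℝ} (h : x < y) : ℓ ^ y < ℓ ^ x := Real.rpow_lt_rpow_of_exponent_gt hℓ0 hℓ1 h
  have hprod : 4 * c ≤ (n : ℝ) * (c * K : ℕ) * ℓ := by
    have h₁ : 4 ≤ ℓ ^ (-(γ + η)) * ℓ ^ (-(1 - γ + η)) * ℓ := by
      have h₂ : ℓ ^ (-(γ + η)) * ℓ ^ (-(1 - γ + η)) * ℓ = ℓ ^ (-η) * ℓ ^ (-η) := by
        nth_rewrite 3 [← Real.rpow_one ℓ]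
        rw [← Real.rpow_add hℓ0, ← Real.rpow_add hℓ0, ← Real.rpow_add hℓ0]
        congr 1; ring
      rw [h₂, hℓη]; nlinarith
    have h₃ : ℓ ^ (-(γ + η)) * ℓ ^ (-(1 - γ + η)) * ℓ ≤ n * K * ℓ := by gcongr
    push_cast
    nlinarith
  obtain ⟨n', hn'⟩ : ∃ n' : ℕ, n' = c * K := ⟨_, rfl⟩
  have hKn' : (K : ℝ) ≤ n' := by
    rw [hn']; exact_mod_cast Nat.le_mul_of_pos_left K hc0
  have hn'0 : 0 < n' := by rw [hn']; positivity
  have hcn' : c ∣ n' := ⟨K, hn'⟩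
  rw [← hn'] at hKU hKℓ hprod
  have hn0R : (0 : ℝ) < n := by exact_mod_cast hn0
  have hn'0R : (0 : ℝ) < n' := by exact_mod_cast hn'0
  set p : ℝ := (1 - ℓ) / n with hp
  set q : ℝ := (1 - ℓ) / n' with hq
  have hpn : p * n = 1 - ℓ := div_mul_cancel₀ _ hn0R.ne'
  have hqn : q * n' = 1 - ℓ := div_mul_cancel₀ _ hn'0R.ne'
  have hpℓ : ℓ < p := by rw [hp, lt_div_iff₀ hn0R]; linarith
  have hqℓ : ℓ < q := by rw [hq, lt_div_iff₀ hn'0R]; linarith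
  have hp0 : 0 < p := hℓ0.trans hpℓ
  have hq0 : 0 < q := hℓ0.trans hqℓ
  refine ⟨ℓ, n, n', 1 / n, 3 / 4, 1 / 2, 1 / 8, fun i => 1 - ℓ - p * (i : ℕ),
    fun j => q * (j : ℕ), fun j => ⟨j % c, Nat.mod_lt _ hc0⟩, hℓ0, hℓ1, hn0, hn'0, hcn',
    by positivity, by norm_num, by norm_num, by norm_num, ?_, ?_, ?_, ?_,
    ⟨(hanti' (by linarith)).trans_le hnA, hnU.trans_le (hanti (by linarith))⟩,
    ⟨((hanti' (by linarith)).trans_le hKB).trans_le hKn', hKU.trans_le (hanti (by linarith))⟩,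
    ?_, ?_, ?_⟩
  · intro i j hij
    have : ((i : ℕ) : ℝ) < (j : ℕ) := by exact_mod_cast hij
    have := mul_lt_mul_of_pos_left this hp0
    simp only
    linarith
  · intro i j hij
    have : ((i : ℕ) : ℝ) < (j : ℕ) := by exact_mod_cast hij
    exact mul_lt_mul_of_pos_left this hq0
  · intro i
    have : ((i : ℕ) : ℝ) ≤ n := by exact_mod_cast i.2.le
    have := mul_le_mul_of_nonneg_left this hp0.le
    have : 0 ≤ p * (i : ℕ) := by positivity
    constructor <;> simp only <;> linarith
  · intro j
    have : ((j : ℕ) : ℝ) ≤ n' := by exact_mod_cast j.2.le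
    have := mul_le_mul_of_nonneg_left this hq0.le
    exact ⟨by positivity, by simp only; linarith⟩
  · intro i h
    push_cast
    linarith
  · intro j h
    push_cast
    linarith
  · intro τ hτ l
    obtain ⟨hτ₁, hτ₂⟩ := hτ
    set s : ℝ := (1 - ℓ) / (n * n') with hs
    have hnn' : (0 : ℝ) < n * n' := by positivity
    have hs0 : 0 < s := div_pos (by linarith) hnn'
    have hsn : s * (n * n') = 1 - ℓ := div_mul_cancel₀ _ hnn'.ne'
    have hsc : s * c ≤ ℓ / 4 := by
      rw [hs, div_mul_eq_mul_div, div_le_iff₀ hnn']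
      nlinarith
    obtain ⟨y, hy₁, hy₂⟩ := exists_arith_progression_mem_Icc (w := 1 - ℓ - τ + 3 * ℓ / 8) hs0 l.2
      (by linarith)
    obtain ⟨x, hx⟩ : ∃ x : ℕ, x = c * y + l := ⟨_, rfl⟩
    rw [← hx] at hy₁ hy₂
    have hxlt : x < n * n' := by
      have : s * x < s * (n * n') := by linarith
      exact_mod_cast lt_of_mul_lt_mul_left this hs0.le
    refine ⟨⟨x / n', Nat.div_lt_of_lt_mul (by rwa [mul_comm])⟩, ⟨x % n', Nat.mod_lt _ hn'0⟩,
      ?_, ?_⟩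
    · ext
      simp only
      rw [Nat.mod_mod_of_dvd _ hcn', hx, Nat.mul_add_mod, Nat.mod_eq_of_lt l.2]
    · have hdm : (n' : ℝ) * (x / n' : ℕ) + (x % n' : ℕ) = x := by
        exact_mod_cast Nat.div_add_mod x n'
      have hval : 1 / (n : ℝ) * (q * (x % n' : ℕ)) + τ - (1 - ℓ - p * (x / n' : ℕ)) =
          s * x + τ - (1 - ℓ) := by
        rw [← hdm, hs, hp, hq]
        field_simp
        ring
      simp only [hval]
      rw [Set.mem_Icc, inv_mul_eq_div, le_div_iff₀ hℓ0, div_le_iff₀ hℓ0]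
      constructor <;> linarith
end

section
/- Let n ≥ 1 and d ≥ 1 be integers, let ℓ ∈ (0,1), and let t₁ < t₂ < ⋯ < t_n be real numbers in [0, 1 − ℓ] with t_{i+1} − t_i > ℓ for all 1 ≤ i < n. Let K ⊆ ℝ be a nonempty compact set satisfying K = ⋃_{i=1}^n (ℓ·K + t_i). Then the d-fold Cartesian product K^d ⊆ ℝ^d has Hausdorff dimension equal to d·(log n)/(log(1/ℓ)). -/
open scoped ENNReal

open Filter Topology MeasureTheory

/-- The point of the attractor of `{x ↦ ℓx + t i}` coded by the sequence `a`. -/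
noncomputable def codedPoint {ι : Type*} (ℓ : ℝ) (t : ι → ℝ) (a : ℕ → ι) : ℝ :=
  ∑' k, ℓ ^ k * t (a k)

section Coding

variable {ι : Type*} {ℓ : ℝ} {t : ι → ℝ}

theorem summable_codedPoint (hℓ0 : 0 < ℓ) (hℓ1 : ℓ < 1)
    (htmem : ∀ i, t i ∈ Set.Icc (0 : ℝ) (1 - ℓ)) (a : ℕ → ι) :
    Summable fun k => ℓ ^ k * t (a k) := by
  refine Summable.of_nonneg_of_le (fun k => mul_nonneg (by positivity) (htmem _).1)
    (fun k => ?_) (summable_geometric_of_lt_one hℓ0.le hℓ1)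
  have := (htmem (a k)).2
  exact mul_le_of_le_one_right (by positivity) (by linarith)

theorem codedPoint_mem_Icc (hℓ0 : 0 < ℓ) (hℓ1 : ℓ < 1)
    (htmem : ∀ i, t i ∈ Set.Icc (0 : ℝ) (1 - ℓ)) (a : ℕ → ι) :
    codedPoint ℓ t a ∈ Set.Icc (0 : ℝ) 1 := by
  have hs := summable_geometric_of_lt_one hℓ0.le hℓ1
  refine ⟨tsum_nonneg fun k => mul_nonneg (by positivity) (htmem _).1, ?_⟩
  calc codedPoint ℓ t a ≤ ∑' k, ℓ ^ k * (1 - ℓ) :=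
        (summable_codedPoint hℓ0 hℓ1 htmem a).tsum_le_tsum
          (fun k => mul_le_mul_of_nonneg_left (htmem _).2 (by positivity)) (hs.mul_right _)
    _ = 1 := by
        rw [tsum_mul_right, tsum_geometric_of_lt_one hℓ0.le hℓ1]
        exact inv_mul_cancel₀ (by linarith)

theorem codedPoint_eq_add (hℓ0 : 0 < ℓ) (hℓ1 : ℓ < 1)
    (htmem : ∀ i, t i ∈ Set.Icc (0 : ℝ) (1 - ℓ)) (a : ℕ → ι) :
    codedPoint ℓ t a = t (a 0) + ℓ * codedPoint ℓ t fun k => a (k + 1) := by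
  rw [codedPoint, (summable_codedPoint hℓ0 hℓ1 htmem a).tsum_eq_zero_add, codedPoint,
    ← tsum_mul_left]
  simp [pow_succ', mul_assoc]

theorem mul_pow_le_abs_codedPoint_sub (hℓ0 : 0 < ℓ) (hℓ1 : ℓ < 1)
    (htmem : ∀ i, t i ∈ Set.Icc (0 : ℝ) (1 - ℓ)) {δ : ℝ}
    (hδ : ∀ i j, i ≠ j → δ + ℓ ≤ |t i - t j|) (m : ℕ) :
    ∀ a b : ℕ → ι, (∀ k < m, a k = b k) → a m ≠ b m →
      δ * ℓ ^ m ≤ |codedPoint ℓ t a - codedPoint ℓ t b| := by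
  induction m with
  | zero =>
    intro a b _ hab
    have h := hδ _ _ hab
    have ha := codedPoint_mem_Icc hℓ0 hℓ1 htmem fun k => a (k + 1)
    have hb := codedPoint_mem_Icc hℓ0 hℓ1 htmem fun k => b (k + 1)
    rw [codedPoint_eq_add hℓ0 hℓ1 htmem a, codedPoint_eq_add hℓ0 hℓ1 htmem b]
    set x := codedPoint ℓ t fun k => a (k + 1)
    set y := codedPoint ℓ t fun k => b (k + 1)
    have hxy : |ℓ * (y - x)| ≤ ℓ := by
      rw [abs_mul, abs_of_pos hℓ0]
      exact mul_le_of_le_one_right hℓ0.le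
        (abs_le.2 ⟨by linarith [ha.2, hb.1], by linarith [ha.1, hb.2]⟩)
    have h3 := abs_sub_abs_le_abs_sub (t (a 0) - t (b 0)) (ℓ * (y - x))
    have h4 : t (a 0) + ℓ * x - (t (b 0) + ℓ * y) = t (a 0) - t (b 0) - ℓ * (y - x) := by ring
    rw [h4, pow_zero, mul_one]
    linarith
  | succ m ih =>
    intro a b h hab
    have h1 := ih (fun k => a (k + 1)) (fun k => b (k + 1)) (fun k hk => h _ (by omega)) hab
    rw [codedPoint_eq_add hℓ0 hℓ1 htmem a, codedPoint_eq_add hℓ0 hℓ1 htmem b, h 0 (by omega),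
      add_sub_add_left_eq_sub, ← mul_sub, abs_mul, abs_of_pos hℓ0, pow_succ]
    nlinarith

theorem codedPoint_mem (hℓ0 : 0 < ℓ) (hℓ1 : ℓ < 1)
    (htmem : ∀ i, t i ∈ Set.Icc (0 : ℝ) (1 - ℓ)) {K : Set ℝ} (hKne : K.Nonempty)
    (hK : IsClosed K) (hKmap : ∀ i, ∀ x ∈ K, ℓ * x + t i ∈ K) (a : ℕ → ι) :
    codedPoint ℓ t a ∈ K := by
  obtain ⟨x, hx⟩ := hKne
  have hpart : ∀ (m : ℕ) (a : ℕ → ι),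
      (∑ k ∈ Finset.range m, ℓ ^ k * t (a k)) + ℓ ^ m * x ∈ K := by
    intro m
    induction m with
    | zero => simp [hx]
    | succ m ih =>
      intro a
      convert hKmap (a 0) _ (ih fun k => a (k + 1)) using 1
      rw [Finset.sum_range_succ', mul_add, Finset.mul_sum]
      simp only [pow_succ', mul_assoc, pow_zero, one_mul]
      ring
  have hlim := (summable_codedPoint hℓ0 hℓ1 htmem a).hasSum.tendsto_sum_nat.add
    ((tendsto_pow_atTop_nhds_zero_of_lt_one hℓ0.le hℓ1).mul_const x)
  rw [zero_mul, add_zero] at hlim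
  exact hK.mem_of_tendsto hlim (Eventually.of_forall fun m => hpart m a)

end Coding

theorem HolderOnWith.pi {ι X Y : Type*} [Fintype ι] [PseudoEMetricSpace X] [PseudoEMetricSpace Y]
    {C r : NNReal} {f : X → Y} {s : Set X} (hf : HolderOnWith C r f s) :
    HolderOnWith C r (fun (x : ι → X) i => f (x i)) (Set.univ.pi fun _ => s) := by
  intro x hx y hy
  refine edist_pi_le_iff.2 fun i => (hf _ (hx i trivial) _ (hy i trivial)).trans ?_
  gcongr
  exact edist_le_pi_edist x y i

theorem dimH_pi_Icc (d : ℕ) : dimH (Set.univ.pi fun _ : Fin d => Set.Icc (0 : ℝ) 1) = d := by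
  have h : (Set.univ.pi fun _ : Fin d => Set.Icc (0 : ℝ) 1) ∈ 𝓝 (fun _ => (1 / 2 : ℝ)) :=
    set_pi_mem_nhds Set.finite_univ fun _ _ => Icc_mem_nhds (by norm_num) (by norm_num)
  rw [Real.dimH_of_mem_nhds h]
  simp

/-- A separated family of translations indexed by a finite type has a uniform gap. -/
theorem exists_uniform_gap {ι : Type*} [Finite ι] {ℓ : ℝ} {t : ι → ℝ}
    (h : ∀ i j, i ≠ j → ℓ < |t i - t j|) :
    ∃ δ : ℝ, 0 < δ ∧ ∀ i j, i ≠ j → δ + ℓ ≤ |t i - t j| := by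
  have : ∀ᶠ δ in 𝓝[>] (0 : ℝ), ∀ i j, i ≠ j → δ + ℓ ≤ |t i - t j| := by
    refine eventually_all.2 fun i => eventually_all.2 fun j => ?_
    by_cases hij : i = j
    · simp [hij]
    · have := h i j hij
      filter_upwards [Ioo_mem_nhdsGT (sub_pos.2 this)] with δ hδ _
      linarith [hδ.2]
  obtain ⟨δ, h1, h2⟩ := (this.and self_mem_nhdsWithin).exists
  exact ⟨δ, h2, h1⟩

theorem rpow_log_div_log_inv {n : ℕ} (hn : 1 ≤ n) {ℓ : ℝ} (hℓ0 : 0 < ℓ) (hℓ1 : ℓ < 1) :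
    ℓ ^ (Real.log n / Real.log (1 / ℓ)) = (n : ℝ)⁻¹ := by
  have hn' : (0 : ℝ) < n := by exact_mod_cast hn
  have hlog := Real.log_neg hℓ0 hℓ1
  rw [Real.rpow_def_of_pos hℓ0, one_div, Real.log_inv, ← Real.exp_log (inv_pos.2 hn'),
    Real.log_inv]
  congr 1
  have := hlog.ne
  field_simp

/-- The base-`n` expansion is Hölder as a function of the coded point. -/
theorem abs_ofDigits_sub_le {n : ℕ} (hn : 1 ≤ n) {ℓ : ℝ} (hℓ0 : 0 < ℓ) (hℓ1 : ℓ < 1)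
    {t : Fin n → ℝ} (htmem : ∀ i, t i ∈ Set.Icc (0 : ℝ) (1 - ℓ)) {δ : ℝ} (hδ0 : 0 < δ)
    (hδ : ∀ i j, i ≠ j → δ + ℓ ≤ |t i - t j|) (a b : ℕ → Fin n) :
    |Real.ofDigits a - Real.ofDigits b| ≤
      δ⁻¹ ^ (Real.log n / Real.log (1 / ℓ)) *
        |codedPoint ℓ t a - codedPoint ℓ t b| ^ (Real.log n / Real.log (1 / ℓ)) := by
  have hs : 0 ≤ Real.log n / Real.log (1 / ℓ) :=
    div_nonneg (Real.log_natCast_nonneg n) (Real.log_nonneg (by rw [le_div_iff₀ hℓ0]; linarith))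
  by_cases hab : a = b
  · subst hab
    rw [sub_self, abs_zero]
    positivity
  have hex : ∃ k, a k ≠ b k := Function.ne_iff.1 hab
  classical
  have hlt : ∀ k < Nat.find hex, a k = b k := fun k hk => not_not.1 (Nat.find_min hex hk)
  have h1 := mul_pow_le_abs_codedPoint_sub hℓ0 hℓ1 htmem hδ _ a b hlt (Nat.find_spec hex)
  refine (Real.abs_ofDigits_sub_ofDigits_le hlt).trans ?_
  rw [← Real.mul_rpow (by positivity) (abs_nonneg _), ← inv_pow, ← rpow_log_div_log_inv hn hℓ0 hℓ1,
    ← Real.rpow_natCast, ← Real.rpow_mul hℓ0.le, mul_comm (_ / _) _, Real.rpow_mul hℓ0.le,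
    Real.rpow_natCast]
  refine Real.rpow_le_rpow (by positivity) ?_ hs
  rwa [inv_mul_eq_div, le_div_iff₀ hδ0, mul_comm]

theorem le_dimH_pi_of_forall_mem {n : ℕ} (hn : 1 < n) (d : ℕ) {ℓ : ℝ} (hℓ0 : 0 < ℓ) (hℓ1 : ℓ < 1)
    {t : Fin n → ℝ} (htmem : ∀ i, t i ∈ Set.Icc (0 : ℝ) (1 - ℓ))
    (hsep : ∀ i j, i ≠ j → ℓ < |t i - t j|) {K : Set ℝ} (hKne : K.Nonempty) (hK : IsClosed K)
    (hKmap : ∀ i, ∀ x ∈ K, ℓ * x + t i ∈ K) :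
    (d : ℝ≥0∞) * ENNReal.ofReal (Real.log n / Real.log (1 / ℓ)) ≤
      dimH (Set.univ.pi fun _ : Fin d => K) := by
  obtain ⟨δ, hδ0, hδ⟩ := exists_uniform_gap hsep
  have hH := abs_ofDigits_sub_le hn.le hℓ0 hℓ1 htmem hδ0 hδ
  have hs : 0 < Real.log n / Real.log (1 / ℓ) :=
    div_pos (Real.log_pos (by exact_mod_cast hn))
      (Real.log_pos (by rw [lt_div_iff₀ hℓ0]; linarith))
  set s := Real.log n / Real.log (1 / ℓ)
  have : Nonempty (ℕ → Fin n) := ⟨fun _ => ⟨0, by omega⟩⟩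
  set P : Set ℝ := Set.range (codedPoint ℓ t)
  set φ : ℝ → ℝ := fun x => Real.ofDigits (Function.invFun (codedPoint ℓ t) x)
  have hinv : ∀ x ∈ P, codedPoint ℓ t (Function.invFun (codedPoint ℓ t) x) = x :=
    fun x hx => Function.invFun_eq hx
  have hφ : HolderOnWith (δ⁻¹ ^ s).toNNReal s.toNNReal φ P := by
    intro x hx y hy
    have h := hH (Function.invFun (codedPoint ℓ t) x) (Function.invFun (codedPoint ℓ t) y)
    rw [hinv x hx, hinv y hy] at h
    rw [edist_dist, edist_dist, Real.dist_eq, Real.dist_eq, Real.coe_toNNReal s hs.le,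
      ENNReal.ofReal_rpow_of_nonneg (abs_nonneg _) hs.le]
    change _ ≤ ENNReal.ofReal _ * _
    rw [← ENNReal.ofReal_mul (by positivity)]
    exact ENNReal.ofReal_le_ofReal h
  have hsurj : Set.Icc (0 : ℝ) 1 ⊆ φ '' P := by
    intro y hy
    obtain ⟨a, -, rfl⟩ := Real.ofDigits_SurjOn hn hy
    refine ⟨codedPoint ℓ t a, ⟨a, rfl⟩, ?_⟩
    have h := hH (Function.invFun (codedPoint ℓ t) (codedPoint ℓ t a)) a
    rw [hinv _ ⟨a, rfl⟩, sub_self, abs_zero, Real.zero_rpow hs.ne', mul_zero] at h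
    exact sub_eq_zero.1 (abs_nonpos_iff.1 h)
  have hcube : (Set.univ.pi fun _ : Fin d => Set.Icc (0 : ℝ) 1) ⊆
      (fun (x : Fin d → ℝ) i => φ (x i)) '' (Set.univ.pi fun _ => P) := by
    intro y hy
    choose x hx hxy using fun i => hsurj (hy i trivial)
    exact ⟨x, fun i _ => hx i, funext hxy⟩
  have hdim := (dimH_mono hcube).trans (hφ.pi.dimH_image_le (Real.toNNReal_pos.2 hs))
  rw [dimH_pi_Icc] at hdim
  refine (ENNReal.mul_le_of_le_div hdim).trans (dimH_mono (Set.pi_mono fun _ _ => ?_))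
  rintro _ ⟨a, rfl⟩
  exact codedPoint_mem hℓ0 hℓ1 htmem hKne hK hKmap a

/-- A self-similar set is covered by its cylinders of level `k`. -/
theorem exists_cylinder_cover {ι : Type*} {ℓ : ℝ} {t : ι → ℝ} {K : Set ℝ}
    (hK : ∀ x ∈ K, ∃ i, ∃ y ∈ K, ℓ * y + t i = x) (k : ℕ) :
    ∃ c : (Fin k → ι) → ℝ, ∀ x ∈ K, ∃ w, ∃ y ∈ K, ℓ ^ k * y + c w = x := by
  induction k with
  | zero => exact ⟨fun _ => 0, fun x hx => ⟨Fin.elim0, x, hx, by simp⟩⟩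
  | succ k ih =>
    obtain ⟨c, hc⟩ := ih
    refine ⟨fun w => t (w 0) + ℓ * c (Fin.tail w), fun x hx => ?_⟩
    obtain ⟨i, y, hy, rfl⟩ := hK x hx
    obtain ⟨w, z, hz, rfl⟩ := hc y hy
    refine ⟨Fin.cons i w, z, hz, ?_⟩
    simp only [Fin.cons_zero, Fin.tail_cons]
    ring

theorem dimH_pi_le_of_forall_exists {n : ℕ} (hn : 1 ≤ n) (d : ℕ) {ℓ : ℝ} (hℓ0 : 0 < ℓ)
    (hℓ1 : ℓ < 1) {t : Fin n → ℝ} {K : Set ℝ} (hKbdd : Bornology.IsBounded K)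
    (hK : ∀ x ∈ K, ∃ i, ∃ y ∈ K, ℓ * y + t i = x) :
    dimH (Set.univ.pi fun _ : Fin d => K) ≤
      (d : ℝ≥0∞) * ENNReal.ofReal (Real.log n / Real.log (1 / ℓ)) := by
  have hs : 0 ≤ Real.log n / Real.log (1 / ℓ) :=
    div_nonneg (Real.log_natCast_nonneg n) (Real.log_nonneg (by rw [le_div_iff₀ hℓ0]; linarith))
  have hpow := rpow_log_div_log_inv hn hℓ0 hℓ1
  set s := Real.log n / Real.log (1 / ℓ)
  have hn' : (0 : ℝ) < n := by exact_mod_cast hn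
  obtain ⟨R, hR⟩ := Metric.isBounded_iff.1 hKbdd
  choose c hc using exists_cylinder_cover hK
  let U : ∀ k : ℕ, (Fin d → Fin k → Fin n) → Set (Fin d → ℝ) :=
    fun k W => Set.univ.pi fun j => (fun y => ℓ ^ k * y + c k (W j)) '' K
  have hdiam : ∀ k W, Metric.ediam (U k W) ≤ ENNReal.ofReal (ℓ ^ k * max R 0) := by
    intro k W
    refine Metric.ediam_pi_le_of_le fun j => Metric.ediam_le_of_forall_dist_le ?_
    rintro _ ⟨x, hx, rfl⟩ _ ⟨y, hy, rfl⟩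
    rw [dist_add_right, Real.dist_eq, ← mul_sub, abs_mul, abs_of_pos (by positivity)]
    exact mul_le_mul_of_nonneg_left ((hR hx hy).trans (le_max_left _ _)) (by positivity)
  have hcover : ∀ k, (Set.univ.pi fun _ : Fin d => K) ⊆ ⋃ W, U k W := by
    intro k x hx
    choose W y hy hxy using fun j => hc k (x j) (hx j trivial)
    exact Set.mem_iUnion.2 ⟨W, fun j _ => ⟨y j, hy j, hxy j⟩⟩
  have hlim : Tendsto (fun k : ℕ => ENNReal.ofReal (ℓ ^ k * max R 0)) atTop (𝓝 0) := by
    have := ENNReal.tendsto_ofReal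
      ((tendsto_pow_atTop_nhds_zero_of_lt_one hℓ0.le hℓ1).mul_const (max R 0))
    simpa using this
  have hsd : (0 : ℝ) ≤ d * s := by positivity
  have hsum : ∀ k, ∑ W, Metric.ediam (U k W) ^ (d * s) ≤ ENNReal.ofReal (max R 0 ^ (d * s)) := by
    intro k
    have hcard : (n : ℝ) ^ (k * d) * (ℓ ^ k * max R 0) ^ (d * s) = max R 0 ^ (d * s) := by
      have : (ℓ ^ k) ^ (d * s) = ((n : ℝ) ^ (k * d))⁻¹ := by
        rw [← Real.rpow_natCast, ← Real.rpow_mul hℓ0.le,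
          show (k : ℝ) * (d * s) = s * (k * d : ℕ) by push_cast; ring, Real.rpow_mul hℓ0.le, hpow,
          Real.rpow_natCast, inv_pow]
      rw [Real.mul_rpow (by positivity) (le_max_right _ _), this, ← mul_assoc,
        mul_inv_cancel₀ (by positivity), one_mul]
    calc ∑ W, Metric.ediam (U k W) ^ (d * s)
        ≤ ∑ _W : Fin d → Fin k → Fin n, ENNReal.ofReal ((ℓ ^ k * max R 0) ^ (d * s)) := by
          refine Finset.sum_le_sum fun W _ => ?_
          rw [← ENNReal.ofReal_rpow_of_nonneg (by positivity) hsd]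
          exact ENNReal.rpow_le_rpow (hdiam k W) hsd
      _ = ENNReal.ofReal (max R 0 ^ (d * s)) := by
          rw [← hcard, ENNReal.ofReal_mul (by positivity), ENNReal.ofReal_pow hn'.le,
            ENNReal.ofReal_natCast]
          simp [pow_mul]
  have hμ : μH[((d * s.toNNReal : NNReal) : ℝ)] (Set.univ.pi fun _ : Fin d => K) ≠ ∞ := by
    rw [NNReal.coe_mul, NNReal.coe_natCast, Real.coe_toNNReal s hs]
    refine ne_top_of_le_ne_top (ENNReal.ofReal_ne_top (r := max R 0 ^ (d * s)))
      ((Measure.hausdorffMeasure_le_liminf_sum (d * s) _ _ hlim U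
        (Eventually.of_forall hdiam) (Eventually.of_forall hcover)).trans
        (liminf_le_of_le (by isBoundedDefault) fun b hb => ?_))
    obtain ⟨k, hk⟩ := hb.exists
    exact hk.trans (hsum k)
  have := dimH_le_of_hausdorffMeasure_ne_top hμ
  rwa [ENNReal.coe_mul, ENNReal.coe_natCast] at this

theorem lt_abs_sub_of_consecutive_gap {n : ℕ} {ℓ : ℝ} {t : Fin n → ℝ} (ht : StrictMono t)
    (hgap : ∀ (i : ℕ) (h : i + 1 < n), t ⟨i + 1, h⟩ - t ⟨i, by omega⟩ > ℓ) (i j : Fin n)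
    (hij : i ≠ j) : ℓ < |t i - t j| := by
  wlog h : j < i generalizing i j
  · rw [abs_sub_comm]
    exact this j i hij.symm (lt_of_le_of_ne (not_lt.1 h) hij)
  have hj : (j : ℕ) + 1 < n := by omega
  have h1 := hgap j hj
  have h2 : t ⟨j + 1, hj⟩ ≤ t i := ht.monotone (Fin.le_def.2 h)
  exact lt_of_lt_of_le (by simpa using (by linarith : ℓ < t i - t j)) (le_abs_self _)

/-- the `d`-fold Cartesian product `K^d ⊆ ℝ^d` of the attractor `K` of a
homogeneous iterated function system `{x ↦ ℓx + t_i}` on `[0,1]` has Hausdorff dimension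
`d·(log n)/(log(1/ℓ))`. -/
theorem stmt_14 (n d : ℕ) (hn : 1 ≤ n) (hd : 1 ≤ d) (ℓ : ℝ) (hℓ0 : 0 < ℓ) (hℓ1 : ℓ < 1)
    (t : Fin n → ℝ) (ht : StrictMono t) (htmem : ∀ i, t i ∈ Set.Icc (0 : ℝ) (1 - ℓ))
    (hgap : ∀ (i : ℕ) (h : i + 1 < n), t ⟨i + 1, h⟩ - t ⟨i, by omega⟩ > ℓ)
    (K : Set ℝ) (hKne : K.Nonempty) (hKcpt : IsCompact K)
    (hKinv : K = ⋃ i, (fun x => ℓ * x + t i) '' K) :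
    dimH (Set.univ.pi fun _ : Fin d => K) =
      (d : ℝ≥0∞) * ENNReal.ofReal (Real.log n / Real.log (1 / ℓ)) := by
  have hKmap : ∀ i, ∀ x ∈ K, ℓ * x + t i ∈ K := fun i x hx => by
    rw [hKinv]
    exact Set.mem_iUnion.2 ⟨i, x, hx, rfl⟩
  have hKex : ∀ x ∈ K, ∃ i, ∃ y ∈ K, ℓ * y + t i = x := fun x hx => by
    rw [hKinv] at hx
    exact Set.mem_iUnion.1 hx
  refine le_antisymm (dimH_pi_le_of_forall_exists hn d hℓ0 hℓ1 hKcpt.isBounded hKex) ?_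
  obtain rfl | hn1 := hn.eq_or_lt
  · simp
  · exact le_dimH_pi_of_forall_mem hn1 d hℓ0 hℓ1 htmem (lt_abs_sub_of_consecutive_gap ht hgap)
      hKne hKcpt.isClosed hKmap
end

section
/- Let d ≥ 1 and let f₁, …, f_n : ℝ^d → ℝ^d be affine maps that are contractions (each Lipschitz with constant < 1), and let U ⊆ ℝ^d be a nonempty compact set with fᵢ(U) ⊆ U for all i. Then there exists a unique nonempty compact set K ⊆ ℝ^d with K = ⋃_{i=1}^n fᵢ(K), and this K satisfies K ⊆ U. Moreover, if n ≥ 2, each fᵢ is injective, and the sets f₁(U), …, f_n(U) are pairwise disjoint, then K is totally disconnected and has no isolated points. -/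
section IteratedFunctionSystem

variable {X ι : Type*} [MetricSpace X] {f : ι → X → X}

/-- Any nonempty compact set mapped into itself by a finite family of continuous maps contains a
nonempty compact set that is the union of its images. -/
theorem exists_invariant_isCompact [Finite ι] [Nonempty ι] (hf : ∀ i, Continuous (f i)) {U : Set X}
    (hne : U.Nonempty) (hU : IsCompact U) (hfU : ∀ i, f i '' U ⊆ U) :
    ∃ K : Set X, K.Nonempty ∧ IsCompact K ∧ K = ⋃ i, f i '' K ∧ K ⊆ U := by
  set H : Set X → Set X := fun A => ⋃ i, f i '' A with hH
  have Hmono : Monotone H := fun A B hAB => Set.iUnion_mono fun i => Set.image_mono hAB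
  have HU : H U ⊆ U := Set.iUnion_subset hfU
  set V : ℕ → Set X := fun k => H^[k] U with hV
  have Vsucc : ∀ k, V (k + 1) = H (V k) := fun k => Function.iterate_succ_apply' H k U
  have Vstep : ∀ k, V (k + 1) ⊆ V k := by
    intro k
    induction k with
    | zero => exact HU
    | succ k ih =>
      have h := Hmono ih
      rwa [← Vsucc, ← Vsucc] at h
  have Vanti : Antitone V := antitone_nat_of_succ_le Vstep
  have Vcpt : ∀ k, IsCompact (V k) := by
    intro k
    induction k with
    | zero => exact hU
    | succ k ih =>
      rw [Vsucc]
      exact isCompact_iUnion fun i => ih.image (hf i)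
  have Vne : ∀ k, (V k).Nonempty := by
    intro k
    induction k with
    | zero => exact hne
    | succ k ih =>
      rw [Vsucc]
      exact Set.nonempty_iUnion.2 ⟨Classical.arbitrary ι, ih.image _⟩
  refine ⟨⋂ k, V k, ?_, hU.of_isClosed_subset (isClosed_iInter fun k => (Vcpt k).isClosed)
    (Set.iInter_subset V 0), ?_, Set.iInter_subset V 0⟩
  · exact IsCompact.nonempty_iInter_of_sequence_nonempty_isCompact_isClosed V Vstep Vne (Vcpt 0)
      fun k => (Vcpt k).isClosed
  · apply Set.Subset.antisymm
    · intro x hx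
      rw [Set.mem_iInter] at hx
      have hex : ∃ i, ∀ k, (V k ∩ f i ⁻¹' {x}).Nonempty := by
        by_contra! hcon
        choose m hm using hcon
        obtain ⟨M, hM⟩ := (Set.finite_range m).bddAbove
        have hxM := hx (M + 1)
        rw [Vsucc] at hxM
        obtain ⟨i, y, hy, rfl⟩ := Set.mem_iUnion.1 hxM
        have hmem : y ∈ V (m i) ∩ f i ⁻¹' {f i y} := ⟨Vanti (hM ⟨i, rfl⟩) hy, rfl⟩
        rw [hm i] at hmem
        exact hmem
      obtain ⟨i, hi⟩ := hex
      have hclosed : IsClosed (f i ⁻¹' {x}) := isClosed_singleton.preimage (hf i)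
      obtain ⟨y, hy⟩ := IsCompact.nonempty_iInter_of_sequence_nonempty_isCompact_isClosed
        (fun k => V k ∩ f i ⁻¹' {x}) (fun k => Set.inter_subset_inter_left _ (Vstep k)) hi
        ((Vcpt 0).inter_right hclosed) fun k => (Vcpt k).isClosed.inter hclosed
      rw [Set.mem_iInter] at hy
      exact Set.mem_iUnion.2 ⟨i, y, Set.mem_iInter.2 fun k => (hy k).1, (hy 0).2⟩
    · refine Set.subset_iInter fun k => (Hmono (Set.iInter_subset V k)).trans ?_
      rw [← Vsucc]
      exact Vstep k

/-- A compact set covered by its images under uniform contractions is contained in every nonempty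
compact set mapped into itself by these contractions. -/
theorem invariant_subset_of_contracting {c : NNReal} (hc : c < 1) (hf : ∀ i, LipschitzWith c (f i))
    {K L : Set X} (hK : IsCompact K) (hKf : K ⊆ ⋃ i, f i '' K)
    (hL : IsCompact L) (hLne : L.Nonempty) (hLf : ⋃ i, f i '' L ⊆ L) : K ⊆ L := by
  rcases K.eq_empty_or_nonempty with rfl | hKne
  · exact Set.empty_subset L
  obtain ⟨x, hxK, hx⟩ := hK.exists_isMaxOn hKne (Metric.continuous_infDist_pt L).continuousOn
  obtain ⟨i, y, hyK, rfl⟩ := Set.mem_iUnion.1 (hKf hxK)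
  obtain ⟨z, hzL, hz⟩ := hL.exists_infDist_eq_dist hLne y
  have h1 : Metric.infDist (f i y) L ≤ c * Metric.infDist y L := by
    rw [hz]
    exact (Metric.infDist_le_dist_of_mem (hLf (Set.mem_iUnion.2 ⟨i, z, hzL, rfl⟩))).trans
      ((hf i).dist_le_mul y z)
  have h2 : Metric.infDist y L ≤ Metric.infDist (f i y) L := hx hyK
  have hc' : (c : ℝ) < 1 := by exact_mod_cast hc
  have h3 : Metric.infDist (f i y) L ≤ 0 := by
    nlinarith [mul_le_mul_of_nonneg_left h2 c.coe_nonneg]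
  intro w hw
  rw [hL.isClosed.mem_iff_infDist_zero hLne]
  exact le_antisymm ((hx hw).trans h3) Metric.infDist_nonneg

/-- A compact set that is the union of its disjoint images under finitely many injective
contractions is totally disconnected. -/
theorem isTotallyDisconnected_of_invariant [Finite ι] {c : NNReal} (hc : c < 1)
    (hf : ∀ i, LipschitzWith c (f i)) (hinj : ∀ i, Function.Injective (f i)) {K : Set X}
    (hK : IsCompact K) (hKf : K ⊆ ⋃ i, f i '' K)
    (hdisj : Pairwise fun i j => Disjoint (f i '' K) (f j '' K)) : IsTotallyDisconnected K := by
  have hclosed : ∀ i, IsClosed (f i '' K) := fun i => (hK.image (hf i).continuous).isClosed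
  have hpiece : ∀ S ⊆ K, IsPreconnected S → ∀ x ∈ S, ∃ i, S ⊆ f i '' K := by
    intro S hSK hS x hx
    obtain ⟨i, hi⟩ := Set.mem_iUnion.1 (hKf (hSK hx))
    have hdisj' : Disjoint (f i '' K) (⋃ j : {j // j ≠ i}, f j '' K) :=
      Set.disjoint_iUnion_right.2 fun j => hdisj j.2.symm
    have hcover : S ⊆ f i '' K ∪ ⋃ j : {j // j ≠ i}, f j '' K := by
      intro y hy
      obtain ⟨j, hj⟩ := Set.mem_iUnion.1 (hKf (hSK hy))
      by_cases hji : j = i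
      · exact Or.inl (hji ▸ hj)
      · exact Or.inr (Set.mem_iUnion.2 ⟨⟨j, hji⟩, hj⟩)
    refine ⟨i, ?_⟩
    rcases isPreconnected_iff_subset_of_disjoint_closed.1 hS _ _ (hclosed i)
      (isClosed_iUnion_of_finite fun j : {j // j ≠ i} => hclosed j) hcover
      (by rw [hdisj'.inter_eq, Set.inter_empty]) with h | h
    · exact h
    · exact absurd (h hx) (Set.disjoint_left.1 hdisj' hi)
  have hbound : ∀ k : ℕ, ∀ S ⊆ K, IsPreconnected S → ∀ x ∈ S, ∀ y ∈ S,
      dist x y ≤ (c : ℝ) ^ k * Metric.diam K := by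
    intro k
    induction k with
    | zero =>
      intro S hSK _ x hx y hy
      simpa using Metric.dist_le_diam_of_mem hK.isBounded (hSK hx) (hSK hy)
    | succ k ih =>
      intro S hSK hS x hx y hy
      obtain ⟨i, hi⟩ := hpiece S hSK hS x hx
      have : CompactSpace K := isCompact_iff_compactSpace.1 hK
      have hpre : IsPreconnected (K.domRestrict (f i) ⁻¹' S) :=
        hS.preimage_of_isClosedMap ((hinj i).comp Subtype.val_injective)
          ((hf i).continuous.comp continuous_subtype_val).isClosedMap
          (by rwa [Set.range_domRestrict])
      obtain ⟨x', hx', rfl⟩ := hi hx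
      obtain ⟨y', hy', rfl⟩ := hi hy
      have h := ih (Subtype.val '' (K.domRestrict (f i) ⁻¹' S)) (Subtype.coe_image_subset K _)
        (hpre.image _ continuous_subtype_val.continuousOn)
        x' ⟨⟨x', hx'⟩, hx, rfl⟩ y' ⟨⟨y', hy'⟩, hy, rfl⟩
      calc dist (f i x') (f i y') ≤ c * dist x' y' := (hf i).dist_le_mul _ _
        _ ≤ c * ((c : ℝ) ^ k * Metric.diam K) := mul_le_mul_of_nonneg_left h c.coe_nonneg
        _ = (c : ℝ) ^ (k + 1) * Metric.diam K := by ring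
  intro S hSK hS x hx y hy
  have hlim : Filter.Tendsto (fun k : ℕ => (c : ℝ) ^ k * Metric.diam K) Filter.atTop (nhds 0) := by
    simpa using (tendsto_pow_atTop_nhds_zero_of_lt_one c.coe_nonneg
      (by exact_mod_cast hc)).mul_const (Metric.diam K)
  exact dist_le_zero.1 (ge_of_tendsto' hlim fun k => hbound k S hSK hS x hx y hy)

/-- A compact set that is the union of its disjoint images under at least two injective
contractions has no isolated points. -/
theorem mem_closure_diff_singleton_of_invariant [Nontrivial ι] {c : NNReal} (hc : c < 1)
    (hf : ∀ i, LipschitzWith c (f i)) (hinj : ∀ i, Function.Injective (f i)) {K : Set X}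
    (hK : IsCompact K) (hKf : K = ⋃ i, f i '' K)
    (hdisj : Pairwise fun i j => Disjoint (f i '' K) (f j '' K)) {x : X} (hx : x ∈ K) :
    x ∈ closure (K \ {x}) := by
  have hmem : ∀ i, ∀ y ∈ K, f i y ∈ K := fun i y hy => by
    rw [hKf]
    exact Set.mem_iUnion.2 ⟨i, y, hy, rfl⟩
  have hbound : ∀ k : ℕ, ∀ x ∈ K, ∃ y ∈ K, y ≠ x ∧ dist x y ≤ (c : ℝ) ^ k * Metric.diam K := by
    intro k
    induction k with
    | zero =>
      intro x hx
      obtain ⟨i, x', hx', rfl⟩ := Set.mem_iUnion.1 (hKf.subset hx)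
      obtain ⟨j, hj⟩ := exists_ne i
      refine ⟨f j x', hmem j x' hx', ?_, ?_⟩
      · exact (hdisj hj).ne_of_mem ⟨x', hx', rfl⟩ ⟨x', hx', rfl⟩
      · simpa using Metric.dist_le_diam_of_mem hK.isBounded hx (hmem j x' hx')
    | succ k ih =>
      intro x hx
      obtain ⟨i, x', hx', rfl⟩ := Set.mem_iUnion.1 (hKf.subset hx)
      obtain ⟨y, hy, hne, hd⟩ := ih x' hx'
      refine ⟨f i y, hmem i y hy, (hinj i).ne hne, ?_⟩
      calc dist (f i x') (f i y) ≤ c * dist x' y := (hf i).dist_le_mul _ _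
        _ ≤ c * ((c : ℝ) ^ k * Metric.diam K) := mul_le_mul_of_nonneg_left hd c.coe_nonneg
        _ = (c : ℝ) ^ (k + 1) * Metric.diam K := by ring
  have hlim : Filter.Tendsto (fun k : ℕ => (c : ℝ) ^ k * Metric.diam K) Filter.atTop (nhds 0) := by
    simpa using (tendsto_pow_atTop_nhds_zero_of_lt_one c.coe_nonneg
      (by exact_mod_cast hc)).mul_const (Metric.diam K)
  rw [Metric.mem_closure_iff]
  intro ε hε
  obtain ⟨k, hk⟩ := (hlim.eventually_lt_const hε).exists
  obtain ⟨y, hy, hne, hd⟩ := hbound k x hx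
  exact ⟨y, ⟨hy, hne⟩, hd.trans_lt hk⟩

end IteratedFunctionSystem


/-- an iterated function system of affine contractions `f i` of `ℝ^d` mapping a
nonempty compact set `U` into itself has a unique nonempty compact attractor
`K = ⋃ᵢ fᵢ(K)`, which is contained in `U`; moreover if `n ≥ 2`, each `fᵢ` is injective and
the images `fᵢ(U)` are pairwise disjoint, then `K` is totally disconnected and has no
isolated points (i.e. `K` is a Cantor set). -/
theorem stmt_15 (d n : ℕ) (hd : 1 ≤ d) (hn : 1 ≤ n)
    (f : Fin n → (EuclideanSpace ℝ (Fin d) →ᵃ[ℝ] EuclideanSpace ℝ (Fin d)))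
    (hcontr : ∀ i, ∃ c : NNReal, c < 1 ∧ LipschitzWith c (f i))
    (U : Set (EuclideanSpace ℝ (Fin d))) (hUne : U.Nonempty) (hUcpt : IsCompact U)
    (hfU : ∀ i, (f i) '' U ⊆ U) :
    ∃ K : Set (EuclideanSpace ℝ (Fin d)),
      (K.Nonempty ∧ IsCompact K ∧ K = ⋃ i, (f i) '' K) ∧
      (∀ K' : Set (EuclideanSpace ℝ (Fin d)),
        (K'.Nonempty ∧ IsCompact K' ∧ K' = ⋃ i, (f i) '' K') → K' = K) ∧
      K ⊆ U ∧
      (2 ≤ n → (∀ i, Function.Injective (f i)) →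
        (Pairwise fun i j => Disjoint ((f i) '' U) ((f j) '' U)) →
        IsTotallyDisconnected K ∧ ∀ x ∈ K, x ∈ closure (K \ {x})) := by
  have : Nonempty (Fin n) := ⟨⟨0, hn⟩⟩
  choose c hc hLip using hcontr
  have hC : Finset.univ.sup c < 1 := (Finset.sup_lt_iff zero_lt_one).2 fun i _ => hc i
  have hf : ∀ i, LipschitzWith (Finset.univ.sup c) (f i) := fun i =>
    (hLip i).weaken (Finset.le_sup (Finset.mem_univ i))
  obtain ⟨K, hne, hK, hKf, hKU⟩ :=
    exists_invariant_isCompact (fun i => (hf i).continuous) hUne hUcpt hfU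
  refine ⟨K, ⟨hne, hK, hKf⟩, ?_, hKU, ?_⟩
  · rintro K' ⟨hne', hK', hKf'⟩
    exact Set.Subset.antisymm
      (invariant_subset_of_contracting hC hf hK' hKf'.subset hK hne hKf.symm.subset)
      (invariant_subset_of_contracting hC hf hK hKf.subset hK' hne' hKf'.symm.subset)
  · intro hn2 hinj hdisjU
    have hdisj : Pairwise fun i j => Disjoint (f i '' K) (f j '' K) := fun i j hij =>
      (hdisjU hij).mono (Set.image_mono hKU) (Set.image_mono hKU)
    have : Nontrivial (Fin n) := Fin.nontrivial_iff_two_le.2 hn2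
    exact ⟨isTotallyDisconnected_of_invariant hC hf hinj hK hKf.subset hdisj,
      fun x hx => mem_closure_diff_singleton_of_invariant hC hf hinj hK hKf hdisj hx⟩
end
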